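/- Let I ⊂ S be a polymatroidal ideal. Then for all k ≥ 1, (m I^{k+1})^{≤(k+1)·deg(I)} = I^{≤deg(I)} · (m I^k)^{≤ k·deg(I)}. -/

import Mathlib

open MvPolynomial

noncomputable section

variable {K : Type*} [Field K] {n : ℕ}

/-- `x^a` is a minimal monomial generator of the monomial ideal `I`:
`x^a ∈ I` and no proper monomial divisor of `x^a` lies in `I`. -/
def MinGen (I : Ideal (MvPolynomial (Fin n) K)) (a : Fin n →₀ ℕ) : Prop :=
  monomial a (1 : K) ∈ I ∧
    ∀ b : Fin n →₀ ℕ, monomial b (1 : K) ∈ I → b ≤ a → b = a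

/-- `I` is a monomial ideal: it is generated by monomials. -/
def IsMonomialIdeal (I : Ideal (MvPolynomial (Fin n) K)) : Prop :=
  ∃ A : Set (Fin n →₀ ℕ),
    I = Ideal.span ((fun a => (monomial a (1 : K) : MvPolynomial (Fin n) K)) '' A)

/-- `I` is generated in a single degree. -/
def Equigenerated (I : Ideal (MvPolynomial (Fin n) K)) : Prop :=
  ∃ d : ℕ, ∀ a, MinGen I a → (∑ s, a s) = d

/-- The exponent vector of `x_j * (u / x_i)` when `u = x^a`. -/
def exchStep (a : Fin n →₀ ℕ) (i j : Fin n) : Fin n →₀ ℕ :=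
  a - Finsupp.single i 1 + Finsupp.single j 1

/-- A monomial ideal, generated in a single degree, is polymatroidal if its minimal
monomial generators satisfy the exchange property. -/
def IsPolymatroidal (I : Ideal (MvPolynomial (Fin n) K)) : Prop :=
  IsMonomialIdeal I ∧ Equigenerated I ∧
    ∀ a b, MinGen I a → MinGen I b → ∀ i : Fin n, b i < a i →
      ∃ j : Fin n, a j < b j ∧ MinGen I (exchStep a i j)

/-- The graded maximal ideal `m = (x_1, …, x_n)`. -/
def maxIdeal (K : Type*) [Field K] (n : ℕ) : Ideal (MvPolynomial (Fin n) K) :=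
  Ideal.span (Set.range X)


/-! ### Bounding multidegree and restriction -/

section DegRest

variable {K : Type*} [Field K] {n : ℕ}

/-- The bounding multidegree `deg(I) = (deg_{x_1}(I), …, deg_{x_n}(I))`, where
`deg_{x_i}(I)` is the maximum of `deg_{x_i}(u)` over the minimal monomial generators `u`. -/
def boundingMultidegree (I : Ideal (MvPolynomial (Fin n) K)) : Fin n → ℕ :=
  fun i => sSup {d : ℕ | ∃ a, MinGen I a ∧ a i = d}

/-- The restriction `I^{≤ c}` of a monomial ideal `I` at `c`: the monomial ideal generated by
the minimal monomial generators `u` of `I` with `deg_{x_i}(u) ≤ c i` for all `i`. -/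
def restriction (I : Ideal (MvPolynomial (Fin n) K)) (c : Fin n → ℕ) :
    Ideal (MvPolynomial (Fin n) K) :=
  Ideal.span {m | ∃ a, MinGen I a ∧ (∀ i, a i ≤ c i) ∧ m = monomial a (1 : K)}

end DegRest

end

open scoped Pointwise in
theorem span_monomial_mul_span_monomial {K : Type*} [Field K] {n : ℕ}
    (A B : Set (Fin n →₀ ℕ)) :
    Ideal.span ((fun a => (monomial a (1 : K) : MvPolynomial (Fin n) K)) '' A) *
        Ideal.span ((fun a => (monomial a (1 : K) : MvPolynomial (Fin n) K)) '' B) =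
      Ideal.span ((fun a => (monomial a (1 : K) : MvPolynomial (Fin n) K)) '' (A + B)) := by
  rw [Ideal.span_mul_span', ← Set.image2_mul, ← Set.image2_add, Set.image2_image_left,
    Set.image2_image_right, Set.image_image2]
  simp only [monomial_mul, mul_one]

open scoped Pointwise in
theorem span_monomial_pow {K : Type*} [Field K] {n : ℕ} (A : Set (Fin n →₀ ℕ)) (k : ℕ) :
    Ideal.span ((fun a => (monomial a (1 : K) : MvPolynomial (Fin n) K)) '' A) ^ k =
      Ideal.span ((fun a => (monomial a (1 : K) : MvPolynomial (Fin n) K)) '' (k • A)) := by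
  induction k with
  | zero => simp [Ideal.one_eq_top]
  | succ k ih => rw [pow_succ, ih, span_monomial_mul_span_monomial, succ_nsmul]

theorem monomial_mem_span_monomial_iff {K : Type*} [Field K] {n : ℕ}
    (A : Set (Fin n →₀ ℕ)) (a : Fin n →₀ ℕ) :
    (monomial a (1 : K) : MvPolynomial (Fin n) K) ∈
        Ideal.span ((fun a => (monomial a (1 : K) : MvPolynomial (Fin n) K)) '' A) ↔
      ∃ b ∈ A, b ≤ a := by
  rw [mem_ideal_span_monomial_image]
  simp

/-- Exponents of the same total degree are incomparable, so they are all minimal generators. -/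
theorem minGen_span_monomial_iff {K : Type*} [Field K] {n : ℕ}
    {A : Set (Fin n →₀ ℕ)} {d : ℕ} (hA : ∀ a ∈ A, a.degree = d) (a : Fin n →₀ ℕ) :
    MinGen (Ideal.span ((fun a => (monomial a (1 : K) : MvPolynomial (Fin n) K)) '' A)) a ↔
      a ∈ A := by
  simp only [MinGen, monomial_mem_span_monomial_iff]
  constructor
  · rintro ⟨⟨b, hb, hba⟩, h⟩
    exact h b ⟨b, hb, le_rfl⟩ hba ▸ hb
  · refine fun ha => ⟨⟨a, ha, le_rfl⟩, ?_⟩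
    rintro b ⟨c, hc, hcb⟩ hba
    obtain ⟨e, rfl⟩ := exists_add_of_le (hcb.trans hba)
    have h := (hA _ ha).trans (hA _ hc).symm
    rw [map_add] at h
    have he : e = 0 := (Finsupp.degree_eq_zero_iff e).1 (by omega)
    subst he
    exact le_antisymm hba (by simpa using hcb)

theorem IsMonomialIdeal.eq_span_minGen {K : Type*} [Field K] {n : ℕ}
    {I : Ideal (MvPolynomial (Fin n) K)} (hI : IsMonomialIdeal I) :
    I = Ideal.span
      ((fun a => (monomial a (1 : K) : MvPolynomial (Fin n) K)) '' {a | MinGen I a}) := by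
  obtain ⟨A, hA⟩ := hI
  apply le_antisymm
  · conv_lhs => rw [hA]
    rw [Ideal.span_le]
    rintro _ ⟨a, ha, rfl⟩
    have haI : (monomial a (1 : K) : MvPolynomial (Fin n) K) ∈ I :=
      hA ▸ Ideal.subset_span ⟨a, ha, rfl⟩
    obtain ⟨b, hba, hb⟩ := exists_minimal_le_of_wellFoundedLT
      (fun b => (monomial b (1 : K) : MvPolynomial (Fin n) K) ∈ I) a haI
    exact (monomial_mem_span_monomial_iff _ _).2
      ⟨b, ⟨hb.1, fun c hc hcb => le_antisymm hcb (hb.2 hc hcb)⟩, hba⟩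
  · rw [Ideal.span_le]
    rintro _ ⟨a, ha, rfl⟩
    exact ha.1

theorem restriction_span_monomial {K : Type*} [Field K] {n : ℕ}
    {A : Set (Fin n →₀ ℕ)} {d : ℕ} (hA : ∀ a ∈ A, a.degree = d) (c : Fin n → ℕ) :
    restriction (Ideal.span
        ((fun a => (monomial a (1 : K) : MvPolynomial (Fin n) K)) '' A)) c =
      Ideal.span ((fun a => (monomial a (1 : K) : MvPolynomial (Fin n) K)) ''
        {a | a ∈ A ∧ ∀ i, a i ≤ c i}) := by
  simp only [restriction, minGen_span_monomial_iff hA]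
  congr 1
  ext m
  simp [and_assoc, eq_comm]

theorem maxIdeal_eq_span_monomial (K : Type*) [Field K] (n : ℕ) :
    maxIdeal K n = Ideal.span ((fun a => (monomial a (1 : K) : MvPolynomial (Fin n) K)) ''
      Set.range fun i => Finsupp.single i 1) := by
  rw [maxIdeal, ← Set.range_comp]
  rfl

open scoped Pointwise in
theorem degree_eq_of_mem_nsmul {n : ℕ} {B : Set (Fin n →₀ ℕ)} {d : ℕ}
    (hB : ∀ a ∈ B, a.degree = d) (k : ℕ) : ∀ a ∈ k • B, a.degree = k * d := by
  induction k with
  | zero => simp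
  | succ k ih =>
    rw [succ_nsmul]
    rintro _ ⟨v, hv, b, hb, rfl⟩
    simp only [map_add, ih v hv, hB b hb]
    ring

open scoped Pointwise in
theorem degree_eq_of_mem_range_single_add {n : ℕ} {A : Set (Fin n →₀ ℕ)} {d : ℕ}
    (hA : ∀ a ∈ A, a.degree = d) :
    ∀ a ∈ (Set.range fun i : Fin n => Finsupp.single i 1) + A, a.degree = 1 + d := by
  rintro _ ⟨_, ⟨i, rfl⟩, a, ha, rfl⟩
  simp [hA a ha]

open scoped Pointwise in
theorem le_mul_of_mem_nsmul {n : ℕ} {B : Set (Fin n →₀ ℕ)} {c : Fin n → ℕ}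
    (hB : ∀ a ∈ B, ∀ i, a i ≤ c i) (k : ℕ) : ∀ a ∈ k • B, ∀ i, a i ≤ k * c i := by
  induction k with
  | zero => simp
  | succ k ih =>
    rw [succ_nsmul]
    rintro _ ⟨v, hv, b, hb, rfl⟩ i
    have h₁ := ih v hv i
    have h₂ := hB b hb i
    simp only [Finsupp.add_apply]
    linarith

open scoped Pointwise in
/-- If a sum of at least two elements of `B` is not extremal in direction `i`, one summand can be
split off so that the remaining sum is still not extremal in direction `i`. -/
theorem exists_add_mem_nsmul_of_lt {n : ℕ} {B : Set (Fin n →₀ ℕ)} {c : Fin n → ℕ}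
    (hB : ∀ a ∈ B, ∀ i, a i ≤ c i) {k : ℕ} (hk : 1 ≤ k) {u : Fin n →₀ ℕ}
    (hu : u ∈ (k + 1) • B) {i : Fin n} (hui : u i < (k + 1) * c i) :
    ∃ b ∈ B, ∃ w ∈ k • B, b + w = u ∧ w i < k * c i := by
  rw [succ_nsmul'] at hu
  obtain ⟨b, hb, w, hw, rfl⟩ := hu
  by_cases hwi : w i < k * c i
  · exact ⟨b, hb, w, hw, rfl, hwi⟩
  obtain ⟨k, rfl⟩ := Nat.exists_eq_add_of_le' hk
  rw [succ_nsmul'] at hw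
  obtain ⟨b', hb', w', hw', rfl⟩ := hw
  refine ⟨b', hb', b + w', ?_, by simp only; abel, ?_⟩
  · rw [succ_nsmul']
    exact Set.add_mem_add hb hw'
  · have h := le_mul_of_mem_nsmul hB k w' hw' i
    simp only [Finsupp.add_apply] at hui hwi ⊢
    linarith

open scoped Pointwise in
theorem bounded_range_single_add_nsmul_succ {n : ℕ} {B : Set (Fin n →₀ ℕ)} {c : Fin n → ℕ}
    (hB : ∀ a ∈ B, ∀ i, a i ≤ c i) {k : ℕ} (hk : 1 ≤ k) :
    {a | a ∈ (Set.range fun i : Fin n => Finsupp.single i 1) + (k + 1) • B ∧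
        ∀ i, a i ≤ (k + 1) * c i} =
      B + {a | a ∈ (Set.range fun i : Fin n => Finsupp.single i 1) + k • B ∧
        ∀ i, a i ≤ k * c i} := by
  ext a
  constructor
  · rintro ⟨⟨_, ⟨i, rfl⟩, u, hu, rfl⟩, hle⟩
    have hi := hle i
    simp only [Finsupp.add_apply, Finsupp.single_eq_same] at hi
    obtain ⟨b, hb, w, hw, rfl, hwi⟩ := exists_add_mem_nsmul_of_lt hB hk hu (i := i) (by omega)
    refine ⟨b, hb, Finsupp.single i 1 + w, ⟨Set.add_mem_add ⟨i, rfl⟩ hw, fun j => ?_⟩,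
      by simp only; abel⟩
    rcases eq_or_ne j i with rfl | hj
    · simp only [Finsupp.add_apply, Finsupp.single_eq_same]
      omega
    · simpa [Finsupp.single_eq_of_ne hj] using le_mul_of_mem_nsmul hB k w hw j
  · rintro ⟨b, hb, _, ⟨⟨e, he, w, hw, rfl⟩, hle⟩, rfl⟩
    refine ⟨⟨e, he, b + w, ?_, by simp only; abel⟩, fun j => ?_⟩
    · rw [succ_nsmul']
      exact Set.add_mem_add hb hw
    · have h₁ := hB b hb j
      have h₂ := hle j
      simp only [Finsupp.add_apply] at h₂ ⊢
      linarith

theorem le_boundingMultidegree {K : Type*} [Field K] {n : ℕ}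
    {I : Ideal (MvPolynomial (Fin n) K)} (hI : Equigenerated I) {a : Fin n →₀ ℕ}
    (ha : MinGen I a) (i : Fin n) : a i ≤ boundingMultidegree I i := by
  obtain ⟨d, hd⟩ := hI
  refine le_csSup ⟨d, ?_⟩ ⟨a, ha, rfl⟩
  rintro _ ⟨b, hb, rfl⟩
  exact hd b hb ▸ Finset.single_le_sum (fun _ _ => Nat.zero_le _) (Finset.mem_univ i)

/-- **Proposition.** Let `I ⊂ S` be a polymatroidal ideal. Then for all `k ≥ 1`,
`(m I^{k+1})^{≤ (k+1)·deg(I)} = I^{≤ deg(I)} · (m I^k)^{≤ k·deg(I)}`. -/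
theorem restriction_power_succ_of_polymatroidal
    {K : Type*} [Field K] {n : ℕ} (I : Ideal (MvPolynomial (Fin n) K))
    (hI : IsPolymatroidal I) :
    ∀ k : ℕ, 1 ≤ k →
      restriction (maxIdeal K n * I ^ (k + 1)) (fun i => (k + 1) * boundingMultidegree I i) =
        restriction I (boundingMultidegree I) *
          restriction (maxIdeal K n * I ^ k) (fun i => k * boundingMultidegree I i) := by
  intro k hk
  obtain ⟨hmon, heq, -⟩ := hI
  have hspan := hmon.eq_span_minGen
  have hle : ∀ a ∈ {a | MinGen I a}, ∀ i, a i ≤ boundingMultidegree I i :=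
    fun a ha => le_boundingMultidegree heq ha
  obtain ⟨d, hd⟩ := heq
  have hdeg : ∀ a ∈ {a | MinGen I a}, a.degree = d := fun a ha => by
    rw [Finsupp.degree_eq_sum, hd a ha]
  generalize boundingMultidegree I = c at hle ⊢
  generalize {a | MinGen I a} = B at hspan hle hdeg
  subst hspan
  rw [maxIdeal_eq_span_monomial, span_monomial_pow, span_monomial_pow,
    span_monomial_mul_span_monomial, span_monomial_mul_span_monomial,
    restriction_span_monomial hdeg,
    restriction_span_monomial
      (degree_eq_of_mem_range_single_add (degree_eq_of_mem_nsmul hdeg (k + 1))),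
    restriction_span_monomial
      (degree_eq_of_mem_range_single_add (degree_eq_of_mem_nsmul hdeg k)),
    span_monomial_mul_span_monomial, bounded_range_single_add_nsmul_succ hle hk,
    Set.sep_eq_self_iff_mem_true.2 hle]
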